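/- Let w be a weight on ℝ with finite dyadic A₂ constant [w]_{A₂}, σ := 1/w, and m, n ≥ 0 integers. For a dyadic interval L define R_L(φw) := ∑_{I ⊆ L, |I| = 2^{−m}|L|} ⟨|φ|w⟩_I (Δ_I w/⟨w⟩_I)(|I|/√|L|) and, symmetrically, R_L(ψσ) := ∑_{J ⊆ L, |J| = 2^{−n}|L|} ⟨|ψ|σ⟩_J (Δ_J σ/⟨σ⟩_J)(|J|/√|L|). Then there is an absolute constant C such that for all φ ∈ L²(w dx), ψ ∈ L²(σ dx): ∑_{L dyadic} R_L(φw) R_L(ψσ) ≤ C (m+n+1)⁴ [w]_{A₂} ‖φ‖_{L²(w)} ‖ψ‖_{L²(σ)}. -/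

import Mathlib

open MeasureTheory Set
open scoped ENNReal Classical

noncomputable section

/-- Length of a dyadic interval of generation `j`. -/
def dlen (j : ℤ) : ℝ := (2 : ℝ) ^ (-j)

/-- The dyadic interval `I_{j,k} = [k·2^{-j}, (k+1)·2^{-j})`. -/
def dyad (j k : ℤ) : Set ℝ := Set.Ico ((k : ℝ) * dlen j) (((k : ℝ) + 1) * dlen j)

/-- Average `⟨f⟩_I` of `f` over the dyadic interval `I = I_{j,k}`. -/
def avg (f : ℝ → ℝ) (j k : ℤ) : ℝ := (dlen j)⁻¹ * ∫ x in dyad j k, f x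

/-- The Haar function `h_I` of the dyadic interval `I = I_{j,k}`. -/
def haar (j k : ℤ) : ℝ → ℝ := fun x =>
  (Real.sqrt (dlen j))⁻¹ *
    ((dyad (j + 1) (2 * k + 1)).indicator (fun _ => (1 : ℝ)) x -
      (dyad (j + 1) (2 * k)).indicator (fun _ => (1 : ℝ)) x)

/-- `Δ_I w` for `I = I_{j,k}`. -/
def dOsc (w : ℝ → ℝ) (j k : ℤ) : ℝ :=
  |avg w (j + 1) (2 * k) - avg w j k| + |avg w (j + 1) (2 * k + 1) - avg w j k|

/-- `R_L(φv) = ∑_{I ⊆ L, |I| = 2^{-m}|L|} ⟨|φ|v⟩_I (Δ_I v/⟨v⟩_I)(|I|/√|L|)`. -/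
def RL (v : ℝ → ℝ) (m : ℕ) (φ : ℝ → ℝ) (j k : ℤ) : ℝ :=
  ∑ ki ∈ Finset.Ico ((2 : ℤ) ^ m * k) ((2 : ℤ) ^ m * (k + 1)),
    avg (fun x => |φ x| * v x) (j + m) ki * (dOsc v (j + m) ki / avg v (j + m) ki) *
      (dlen (j + m) / Real.sqrt (dlen j))

section Tree

variable {α : Type*} (l r : α → α)

/-- Sum of `f` over the `i`-th generation descendants. -/
def LS : ℕ → (α → ℝ) → α → ℝ
  | 0, f, p => f p
  | i + 1, f, p => LS i f (l p) + LS i f (r p)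

/-- Sum of `f` over all descendants of generation `< d`. -/
def TS : ℕ → (α → ℝ) → α → ℝ
  | 0, _, _ => 0
  | d + 1, f, p => f p + (TS d f (l p) + TS d f (r p))

/-- Integral (w.r.t. the additive `e`) of the truncated maximal function of `F`. -/
def GM (F e : α → ℝ) : ℕ → ℝ → α → ℝ
  | 0, M, p => M * e p
  | d + 1, M, p => GM F e d (max M (F p)) (l p) + GM F e d (max M (F p)) (r p)

variable {l r}

lemma LS_mono {f g : α → ℝ} (h : ∀ p, f p ≤ g p) (i : ℕ) (p : α) :
    LS l r i f p ≤ LS l r i g p := by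
  induction i generalizing p with
  | zero => exact h p
  | succ i ih => exact add_le_add (ih _) (ih _)

lemma LS_nonneg {f : α → ℝ} (h : ∀ p, 0 ≤ f p) (i : ℕ) (p : α) : 0 ≤ LS l r i f p := by
  induction i generalizing p with
  | zero => exact h p
  | succ i ih => exact add_nonneg (ih _) (ih _)

lemma LS_const_mul (c : ℝ) (f : α → ℝ) (i : ℕ) (p : α) :
    LS l r i (fun p => c * f p) p = c * LS l r i f p := by
  induction i generalizing p with
  | zero => rfl
  | succ i ih => simp only [LS, ih]; ring

lemma LS_add_eq {f : α → ℝ} (h : ∀ p, f p = f (l p) + f (r p)) (i : ℕ) (p : α) :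
    LS l r i f p = f p := by
  induction i generalizing p with
  | zero => rfl
  | succ i ih => simp only [LS, ih]; exact (h p).symm

lemma LS_succ_le {f : α → ℝ} (h : ∀ p, f p ≤ f (l p) + f (r p)) (i : ℕ) (p : α) :
    LS l r i f p ≤ LS l r (i + 1) f p := by
  induction i generalizing p with
  | zero => exact h p
  | succ i ih => exact add_le_add (ih _) (ih _)

lemma le_LS {f : α → ℝ} (h : ∀ p, f p ≤ f (l p) + f (r p)) (i : ℕ) (p : α) :
    f p ≤ LS l r i f p := by
  induction i with
  | zero => exact le_rfl
  | succ i ih => exact ih.trans (LS_succ_le h i p)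

lemma TS_mono {f g : α → ℝ} (h : ∀ p, f p ≤ g p) (i : ℕ) (p : α) :
    TS l r i f p ≤ TS l r i g p := by
  induction i generalizing p with
  | zero => exact le_rfl
  | succ i ih => exact add_le_add (h p) (add_le_add (ih _) (ih _))

lemma TS_nonneg {f : α → ℝ} (h : ∀ p, 0 ≤ f p) (i : ℕ) (p : α) : 0 ≤ TS l r i f p := by
  induction i generalizing p with
  | zero => exact le_rfl
  | succ i ih => exact add_nonneg (h p) (add_nonneg (ih _) (ih _))

lemma TS_const_mul (c : ℝ) (f : α → ℝ) (i : ℕ) (p : α) :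
    TS l r i (fun p => c * f p) p = c * TS l r i f p := by
  induction i generalizing p with
  | zero => simp [TS]
  | succ i ih => simp only [TS, ih]; ring

lemma TS_succ_le {f : α → ℝ} (h : ∀ p, 0 ≤ f p) (i : ℕ) (p : α) :
    TS l r i f p ≤ TS l r (i + 1) f p := by
  induction i generalizing p with
  | zero => exact TS_nonneg h 1 p
  | succ i ih => exact add_le_add le_rfl (add_le_add (ih _) (ih _))

lemma TS_le {f : α → ℝ} (h : ∀ p, 0 ≤ f p) {i j : ℕ} (hij : i ≤ j) (p : α) :
    TS l r i f p ≤ TS l r j f p :=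
  monotone_nat_of_le_succ (f := fun i => TS l r i f p) (fun i => TS_succ_le h i p) hij

lemma TS_eq_sum (f : α → ℝ) (d : ℕ) (p : α) :
    TS l r d f p = ∑ i ∈ Finset.range d, LS l r i f p := by
  induction d generalizing p with
  | zero => simp [TS]
  | succ d ih =>
    rw [Finset.sum_range_succ']
    simp only [TS, ih, LS, Finset.sum_add_distrib]
    ring

/-- Carleson embedding on a finite tree. -/
lemma carleson {F Θ ℓ : α → ℝ} {B : ℝ}
    (hℓ : ∀ p, ℓ p = ℓ (l p) + ℓ (r p)) (hΘ : ∀ p, 0 ≤ Θ p) (hΘB : ∀ p, Θ p ≤ B * ℓ p)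
    (hsup : ∀ p, Θ (l p) + Θ (r p) ≤ Θ p) (d : ℕ) (M : ℝ) (hM : 0 ≤ M) (p : α) :
    TS l r d (fun p => F p * (Θ p - (Θ (l p) + Θ (r p)))) p ≤
      B * (GM l r F ℓ d M p - M * ℓ p) + M * Θ p := by
  induction d generalizing M p with
  | zero => simp only [TS, GM]; nlinarith [mul_nonneg hM (hΘ p)]
  | succ d ih =>
    have h1 : M ≤ max M (F p) := le_max_left _ _
    have h2 : F p ≤ max M (F p) := le_max_right _ _
    have a1 := ih (max M (F p)) (hM.trans h1) (l p)
    have a2 := ih (max M (F p)) (hM.trans h1) (r p)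
    simp only [TS, GM]
    set M' := max M (F p)
    have b1 := mul_le_mul_of_nonneg_right h2 (sub_nonneg.2 (hsup p))
    have b2 := mul_le_mul_of_nonneg_right h1 (sub_nonneg.2 (hΘB p))
    have b3 := hℓ p
    have b4 : B * (M' * ℓ p) = B * (M' * ℓ (l p)) + B * (M' * ℓ (r p)) := by rw [b3]; ring
    nlinarith

lemma two_cs {x y a b c d : ℝ} (ha : 0 ≤ a) (hb : 0 ≤ b) (hc : 0 ≤ c) (hd : 0 ≤ d)
    (hx : x ≤ √(a * b)) (hy : y ≤ √(c * d)) : x + y ≤ √((a + c) * (b + d)) := by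
  refine (add_le_add hx hy).trans (Real.le_sqrt_of_sq_le ?_)
  rw [Real.sqrt_mul ha, Real.sqrt_mul hc]
  have e1 := Real.sq_sqrt ha
  have e2 := Real.sq_sqrt hb
  have e3 := Real.sq_sqrt hc
  have e4 := Real.sq_sqrt hd
  set p := √a
  set q := √b
  set s := √c
  set t := √d
  rw [← e1, ← e2, ← e3, ← e4]
  nlinarith [sq_nonneg (p * t - q * s)]

lemma GM_nonneg {F e : α → ℝ} (he : ∀ p, 0 ≤ e p) (d : ℕ) (M : ℝ) (hM : 0 ≤ M) (p : α) :
    0 ≤ GM l r F e d M p := by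
  induction d generalizing M p with
  | zero => exact mul_nonneg hM (he p)
  | succ d ih =>
    have h := hM.trans (le_max_left M (F p))
    exact add_nonneg (ih _ h _) (ih _ h _)

lemma GM_cs {F₁ F₂ ℓ W V : α → ℝ} (hℓ : ∀ p, 0 ≤ ℓ p)
    (hW : ∀ p, 0 ≤ W p) (hV : ∀ p, 0 ≤ V p)
    (hF2 : ∀ p, 0 ≤ F₂ p)
    (hWV : ∀ p, (ℓ p) ^ 2 ≤ W p * V p)
    (d : ℕ) (M M₁ M₂ : ℝ) (h1 : 0 ≤ M₁) (h2 : 0 ≤ M₂) (hM : M ≤ √(M₁ * M₂)) (p : α) :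
    GM l r (fun p => √(F₁ p * F₂ p)) ℓ d M p ≤
      √(GM l r F₁ W d M₁ p * GM l r F₂ V d M₂ p) := by
  induction d generalizing M M₁ M₂ p with
  | zero =>
    simp only [GM]
    have : M₁ * W p * (M₂ * V p) = (M₁ * M₂) * (W p * V p) := by ring
    rw [this, Real.sqrt_mul (mul_nonneg h1 h2)]
    exact mul_le_mul hM (Real.le_sqrt_of_sq_le (hWV p)) (hℓ p) (Real.sqrt_nonneg _)
  | succ d ih =>
    have k1 : 0 ≤ max M₁ (F₁ p) := h1.trans (le_max_left _ _)
    have k2 : 0 ≤ max M₂ (F₂ p) := h2.trans (le_max_left _ _)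
    have k3 : max M (√(F₁ p * F₂ p)) ≤ √(max M₁ (F₁ p) * max M₂ (F₂ p)) := by
      refine max_le (hM.trans (Real.sqrt_le_sqrt ?_)) ?_
      · exact mul_le_mul (le_max_left _ _) (le_max_left _ _) h2 k1
      · exact Real.sqrt_le_sqrt
          (mul_le_mul (le_max_right _ _) (le_max_right _ _) (hF2 p) k1)
    simp only [GM]
    exact two_cs (GM_nonneg hW _ _ k1 _) (GM_nonneg hV _ _ k2 _) (GM_nonneg hW _ _ k1 _)
      (GM_nonneg hV _ _ k2 _) (ih _ _ _ k1 k2 k3 _) (ih _ _ _ k1 k2 k3 _)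

lemma sq_div_sub {a W : α → ℝ} (hW : ∀ p, 0 < W p)
    (hWa : ∀ p, W p = W (l p) + W (r p)) (haa : ∀ p, a p = a (l p) + a (r p)) (p : α) :
    a p ^ 2 / W p ≤ a (l p) ^ 2 / W (l p) + a (r p) ^ 2 / W (r p) := by
  rw [hWa, haa]
  have h1 := hW (l p)
  have h2 := hW (r p)
  rw [div_add_div _ _ h1.ne' h2.ne', div_le_div_iff₀ (by positivity) (by positivity)]
  have : 0 ≤ (a (l p) * W (r p) - a (r p) * W (l p)) ^ 2 := sq_nonneg _
  nlinarith

lemma TS_energy (A : α → ℝ) (m d : ℕ) (p : α) :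
    TS l r d (fun p => LS l r m A p - A p) p =
      ∑ i ∈ Finset.range m, (LS l r (d + i) A p - LS l r i A p) := by
  induction d generalizing p with
  | zero => simp [TS]
  | succ d ih =>
    simp only [TS, ih]
    have e : LS l r m A p - A p =
        ∑ i ∈ Finset.range m, (LS l r (i + 1) A p - LS l r i A p) := by
      rw [Finset.sum_range_sub (fun i => LS l r i A p)]; rfl
    rw [e, ← Finset.sum_add_distrib, ← Finset.sum_add_distrib]
    refine Finset.sum_congr rfl fun i _ => ?_
    have : d + 1 + i = (d + i) + 1 := by ring
    rw [this]
    simp only [LS]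
    ring

lemma GM_max_aux {W a X A : α → ℝ} (hW : ∀ p, 0 < W p)
    (hWa : ∀ p, W p = W (l p) + W (r p)) (haa : ∀ p, a p = a (l p) + a (r p))
    (hXa : ∀ p, X p = X (l p) + X (r p)) (ha : ∀ p, 0 ≤ a p)
    (hcs : ∀ p, a p ^ 2 ≤ X p * W p) (hA : ∀ p, a p ^ 2 / W p ≤ A p)
    (d : ℕ) (M t e : ℝ) (ht : 0 ≤ t) (he : 0 ≤ e) (hM : M ≤ t ^ 2 + e) (p : α) :
    GM l r (fun p => A p / W p) W d M p ≤
      2 * t ^ 2 * W p - 4 * t * a p + 4 * X p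
        + TS l r d (fun p => A p - a p ^ 2 / W p) p + e * W p := by
  induction d generalizing M t e p with
  | zero =>
    simp only [GM, TS]
    have h := hW p
    have h1 : a p ^ 2 / W p ≤ X p := by rw [div_le_iff₀ h]; exact hcs p
    have h2 : M * W p ≤ (t ^ 2 + e) * W p := mul_le_mul_of_nonneg_right hM h.le
    have h3 : 0 ≤ (t * W p - 2 * a p) ^ 2 / W p := by positivity
    have h4 : (t * W p - 2 * a p) ^ 2 / W p = t ^ 2 * W p - 4 * t * a p + 4 * (a p ^ 2 / W p) := by
      field_simp; ring
    nlinarith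
  | succ d ih =>
    have h := hW p
    set x := a p / W p with hx
    have hx0 : 0 ≤ x := div_nonneg (ha p) h.le
    set E := (A p - a p ^ 2 / W p) / W p with hE
    have hE0 : 0 ≤ E := div_nonneg (sub_nonneg.2 (hA p)) h.le
    have hAx : A p / W p = x ^ 2 + E := by rw [hx, hE]; field_simp; ring
    have hm : max M (A p / W p) ≤ (max t x) ^ 2 + (e + E) := by
      refine max_le ?_ ?_
      · have := pow_le_pow_left₀ ht (le_max_left t x) 2
        linarith
      · have := pow_le_pow_left₀ hx0 (le_max_right t x) 2
        linarith
    have hmx : 0 ≤ max t x := ht.trans (le_max_left _ _)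
    have i1 := ih _ (max t x) (e + E) hmx (by positivity) hm (l p)
    have i2 := ih _ (max t x) (e + E) hmx (by positivity) hm (r p)
    have hEW : E * W p = A p - a p ^ 2 / W p := by rw [hE]; field_simp
    have key : 2 * (max t x) ^ 2 * W p - 4 * (max t x) * a p ≤ 2 * t ^ 2 * W p - 4 * t * a p := by
      rcases le_total x t with hh | hh
      · rw [max_eq_left hh]
      · rw [max_eq_right hh]
        have : a p = x * W p := by rw [hx]; field_simp
        rw [this]
        nlinarith [mul_nonneg (sq_nonneg (t - x)) h.le]
    simp only [GM, TS]
    have e1 : (e + E) * W (l p) + (e + E) * W (r p) = e * W p + E * W p := by rw [hWa p]; ring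
    have e2 : 2 * (max t x) ^ 2 * W p - 4 * (max t x) * a p =
        (2 * (max t x) ^ 2 * W (l p) - 4 * (max t x) * a (l p)) +
        (2 * (max t x) ^ 2 * W (r p) - 4 * (max t x) * a (r p)) := by rw [hWa p, haa p]; ring
    have e3 := hXa p
    linarith

lemma GM_max {W a X : α → ℝ} (hW : ∀ p, 0 < W p)
    (hWa : ∀ p, W p = W (l p) + W (r p)) (haa : ∀ p, a p = a (l p) + a (r p))
    (hXa : ∀ p, X p = X (l p) + X (r p)) (ha : ∀ p, 0 ≤ a p)
    (hcs : ∀ p, a p ^ 2 ≤ X p * W p) (m d : ℕ) (p : α) :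
    GM l r (fun p => LS l r m (fun p => a p ^ 2 / W p) p / W p) W d 0 p ≤ (4 + m) * X p := by
  have h := GM_max_aux (A := fun p => LS l r m (fun p => a p ^ 2 / W p) p) hW hWa haa hXa ha hcs
    (fun p => le_LS (sq_div_sub hW hWa haa) m p) d 0 0 0 le_rfl le_rfl (by simp) p
  refine h.trans ?_
  have h0 : ∀ p, 0 ≤ a p ^ 2 / W p := fun p => div_nonneg (sq_nonneg _) (hW p).le
  have hX : ∀ i, LS l r i (fun p => a p ^ 2 / W p) p ≤ X p := fun i =>
    (LS_mono (fun p => by rw [div_le_iff₀ (hW p)]; exact hcs p) i p).trans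
      (LS_add_eq hXa i p).le
  have h2 := TS_energy (l := l) (r := r) (fun p => a p ^ 2 / W p) m d p
  have h3 : ∑ i ∈ Finset.range m, (LS l r (d + i) (fun p => a p ^ 2 / W p) p
      - LS l r i (fun p => a p ^ 2 / W p) p) ≤ ∑ i ∈ Finset.range m, X p :=
    Finset.sum_le_sum fun i _ => by linarith [hX (d + i), LS_nonneg (l := l) (r := r) h0 i p]
  rw [Finset.sum_const, Finset.card_range, nsmul_eq_mul] at h3
  linarith

lemma sqrt_pair {s : ℝ} (h1 : -1 ≤ s) (h2 : s ≤ 1) : √(1 - s) + √(1 + s) ≤ 2 - s ^ 2 / 4 := by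
  have e1 := Real.sq_sqrt (show 0 ≤ 1 - s by linarith)
  have e2 := Real.sq_sqrt (show 0 ≤ 1 + s by linarith)
  have h : √(1 - s) * √(1 + s) ≤ 1 - s ^ 2 / 2 := by
    rw [← Real.sqrt_mul (by linarith)]
    refine (Real.sqrt_le_left (by nlinarith)).2 ?_
    nlinarith [sq_nonneg (s ^ 2)]
  refine abs_le_of_sq_le_sq' ?_ (by nlinarith) |>.2
  nlinarith [sq_nonneg (s ^ 2)]

lemma fourth_am (x y : ℝ) (hx : 0 ≤ x) : √√(x * y) ≤ (√x + √y) / 2 := by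
  rw [Real.sqrt_mul hx]
  refine (Real.sqrt_le_left (by positivity)).2 ?_
  nlinarith [sq_nonneg (√x - √y)]

lemma fourth_pair {s t : ℝ} (h1 : -1 ≤ s) (h2 : s ≤ 1) (h3 : -1 ≤ t) (h4 : t ≤ 1) :
    √√((1 - s) * (1 - t)) + √√((1 + s) * (1 + t)) ≤ 2 - (s ^ 2 + t ^ 2) / 8 := by
  have a1 := fourth_am (1 - s) (1 - t) (by linarith)
  have a2 := fourth_am (1 + s) (1 + t) (by linarith)
  have := sqrt_pair h1 h2
  have := sqrt_pair h3 h4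
  linarith

/-- relative half-difference -/
def sg (l r : α → α) (W : α → ℝ) (p : α) : ℝ := (W (r p) - W (l p)) / W p

/-- the Bellman function -/
def bt (ℓ W V : α → ℝ) (p : α) : ℝ := √√(W p / ℓ p * (V p / ℓ p))

lemma sg_bd {W : α → ℝ} (hW : ∀ p, 0 < W p)
    (hWa : ∀ p, W p = W (l p) + W (r p)) (p : α) : -1 ≤ sg l r W p ∧ sg l r W p ≤ 1 := by
  have h1 := hW (l p)
  have h2 := hW (r p)
  have h3 := hWa p
  constructor
  · rw [sg, le_div_iff₀ (hW p)]; linarith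
  · rw [sg, div_le_iff₀ (hW p)]; linarith

lemma W_left {W ℓ : α → ℝ} (hW : ∀ p, 0 < W p)
    (hWa : ∀ p, W p = W (l p) + W (r p)) (hℓl : ∀ p, ℓ (l p) = ℓ p / 2) (p : α) :
    W (l p) / ℓ (l p) = (1 - sg l r W p) * (W p / ℓ p) := by
  have h := hW p
  have h3 := hWa p
  have h4 : (1 - sg l r W p) * W p = 2 * W (l p) := by
    rw [sg, sub_mul, div_mul_cancel₀ _ h.ne']; linarith
  rw [hℓl, ← mul_div_assoc, h4, div_div_eq_mul_div]; ring

lemma W_right {W ℓ : α → ℝ} (hW : ∀ p, 0 < W p)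
    (hWa : ∀ p, W p = W (l p) + W (r p)) (hℓr : ∀ p, ℓ (r p) = ℓ p / 2) (p : α) :
    W (r p) / ℓ (r p) = (1 + sg l r W p) * (W p / ℓ p) := by
  have h := hW p
  have h3 := hWa p
  have h4 : (1 + sg l r W p) * W p = 2 * W (r p) := by
    rw [sg, add_mul, div_mul_cancel₀ _ h.ne']; linarith
  rw [hℓr, ← mul_div_assoc, h4, div_div_eq_mul_div]; ring

lemma bt_left {W V ℓ : α → ℝ} (hW : ∀ p, 0 < W p) (hV : ∀ p, 0 < V p)
    (hWa : ∀ p, W p = W (l p) + W (r p)) (hVa : ∀ p, V p = V (l p) + V (r p))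
    (hℓl : ∀ p, ℓ (l p) = ℓ p / 2) (p : α) :
    bt ℓ W V (l p) = √√((1 - sg l r W p) * (1 - sg l r V p)) * bt ℓ W V p := by
  rw [bt, bt, W_left hW hWa hℓl, W_left hV hVa hℓl]
  have h1 := (sg_bd hW hWa p).2
  have h2 := (sg_bd hV hVa p).2
  have h3 : 0 ≤ (1 - sg l r W p) * (1 - sg l r V p) :=
    mul_nonneg (by linarith) (by linarith)
  rw [mul_mul_mul_comm, Real.sqrt_mul h3, Real.sqrt_mul (Real.sqrt_nonneg _)]

lemma bt_right {W V ℓ : α → ℝ} (hW : ∀ p, 0 < W p) (hV : ∀ p, 0 < V p)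
    (hWa : ∀ p, W p = W (l p) + W (r p)) (hVa : ∀ p, V p = V (l p) + V (r p))
    (hℓr : ∀ p, ℓ (r p) = ℓ p / 2) (p : α) :
    bt ℓ W V (r p) = √√((1 + sg l r W p) * (1 + sg l r V p)) * bt ℓ W V p := by
  rw [bt, bt, W_right hW hWa hℓr, W_right hV hVa hℓr]
  have h1 := (sg_bd hW hWa p).1
  have h2 := (sg_bd hV hVa p).1
  have h3 : 0 ≤ (1 + sg l r W p) * (1 + sg l r V p) :=
    mul_nonneg (by linarith) (by linarith)
  rw [mul_mul_mul_comm, Real.sqrt_mul h3, Real.sqrt_mul (Real.sqrt_nonneg _)]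

/-- the local square density -/
def gg (l r : α → α) (ℓ W V : α → ℝ) (p : α) : ℝ :=
  bt ℓ W V p * (sg l r W p ^ 2 + sg l r V p ^ 2) * ℓ p

lemma bt_nonneg (ℓ W V : α → ℝ) (p : α) : 0 ≤ bt ℓ W V p := Real.sqrt_nonneg _

lemma gg_nonneg {ℓ W V : α → ℝ} (hℓ : ∀ p, 0 < ℓ p) (p : α) : 0 ≤ gg l r ℓ W V p :=
  mul_nonneg (mul_nonneg (bt_nonneg _ _ _ _) (by positivity)) (hℓ p).le

lemma bellman {W V ℓ : α → ℝ} (hW : ∀ p, 0 < W p) (hV : ∀ p, 0 < V p)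
    (hWa : ∀ p, W p = W (l p) + W (r p)) (hVa : ∀ p, V p = V (l p) + V (r p))
    (hℓ : ∀ p, 0 < ℓ p) (hℓl : ∀ p, ℓ (l p) = ℓ p / 2) (hℓr : ∀ p, ℓ (r p) = ℓ p / 2) (p : α) :
    gg l r ℓ W V p ≤ 16 * (bt ℓ W V p * ℓ p -
      (bt ℓ W V (l p) * ℓ (l p) + bt ℓ W V (r p) * ℓ (r p))) := by
  rw [bt_left hW hV hWa hVa hℓl, bt_right hW hV hWa hVa hℓr, hℓl, hℓr, gg]
  have h1 := sg_bd hW hWa p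
  have h2 := sg_bd hV hVa p
  have h := fourth_pair h1.1 h1.2 h2.1 h2.2
  have hb := mul_nonneg (bt_nonneg ℓ W V p) (hℓ p).le
  have := mul_le_mul_of_nonneg_left h hb
  nlinarith

lemma TS_gg {W V ℓ : α → ℝ} (hW : ∀ p, 0 < W p) (hV : ∀ p, 0 < V p)
    (hWa : ∀ p, W p = W (l p) + W (r p)) (hVa : ∀ p, V p = V (l p) + V (r p))
    (hℓ : ∀ p, 0 < ℓ p) (hℓl : ∀ p, ℓ (l p) = ℓ p / 2) (hℓr : ∀ p, ℓ (r p) = ℓ p / 2)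
    (d : ℕ) (p : α) :
    TS l r d (gg l r ℓ W V) p ≤ 16 * (bt ℓ W V p * ℓ p -
      LS l r d (fun p => bt ℓ W V p * ℓ p) p) := by
  induction d generalizing p with
  | zero => simp [TS, LS]
  | succ d ih =>
    simp only [TS, LS]
    linarith [ih (l p), ih (r p), bellman hW hV hWa hVa hℓ hℓl hℓr p]

lemma fourth_lower {x y ρ : ℝ} (h0 : 0 ≤ ρ) (h1 : ρ ≤ 1 / 2) (hx : 1 - ρ ≤ x) (hy : 1 - ρ ≤ y) :
    1 - ρ ≤ √√(x * y) := by
  refine Real.le_sqrt_of_sq_le (Real.le_sqrt_of_sq_le ?_)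
  have h2 : (1 - ρ) * (1 - ρ) ≤ x * y := mul_le_mul hx hy (by linarith) (by linarith)
  have h3 : (1 - ρ) ^ 2 ≤ 1 := by nlinarith
  nlinarith [sq_nonneg (1 - ρ)]

lemma ratio_bd {ρ u b D : ℝ} (h0 : 0 ≤ ρ) (h1 : ρ ≤ 1 / 2) (hu : u ≤ 1 + ρ) (hb : 1 - ρ ≤ b)
    (hD : 0 ≤ D) : u / b * D ≤ (1 + 4 * ρ) * D := by
  refine mul_le_mul_of_nonneg_right ?_ hD
  rw [div_le_iff₀ (by linarith)]
  nlinarith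

lemma T_bound {W V ℓ a : α → ℝ} (hW : ∀ p, 0 < W p) (hV : ∀ p, 0 < V p)
    (hWa : ∀ p, W p = W (l p) + W (r p)) (hVa : ∀ p, V p = V (l p) + V (r p))
    (hℓ : ∀ p, 0 < ℓ p) (hℓl : ∀ p, ℓ (l p) = ℓ p / 2) (hℓr : ∀ p, ℓ (r p) = ℓ p / 2)
    (haa : ∀ p, a p = a (l p) + a (r p)) (ha : ∀ p, 0 ≤ a p)
    (N : ℝ) (hN : 1 ≤ N) (i : ℕ) (p : α) :
    LS l r i (fun p => a p * (2 * |sg l r W p|)) p ≤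
      √(LS l r i (fun p => a p ^ 2 / W p) p *
        (16 * N ^ 2 * (1 + 2 / N) ^ i * (W p / ℓ p / bt ℓ W V p) *
          TS l r (i + 1) (gg l r ℓ W V) p)) := by
  have hbt : ∀ p, 0 < bt ℓ W V p := fun p => by
    have := hW p; have := hV p; have := hℓ p; unfold bt; positivity
  have hA0 : ∀ p, 0 ≤ a p ^ 2 / W p := fun p => div_nonneg (sq_nonneg _) (hW p).le
  have hg := gg_nonneg (l := l) (r := r) (W := W) (V := V) hℓ
  have hq : 1 ≤ 1 + 2 / N := by have : 0 ≤ 2 / N := by positivity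
                                linarith
  have hD : ∀ p, 0 < W p / ℓ p / bt ℓ W V p := fun p =>
    div_pos (div_pos (hW p) (hℓ p)) (hbt p)
  -- the large oscillation case
  have hcase : ∀ (i : ℕ) (p : α) (c : ℝ), 0 ≤ c →
      LS l r i (fun p => a p * (2 * |sg l r W p|)) p ≤ c * a p →
      c ^ 2 ≤ 16 * N ^ 2 * (sg l r W p ^ 2 + sg l r V p ^ 2) →
      LS l r i (fun p => a p * (2 * |sg l r W p|)) p ≤
      √(LS l r i (fun p => a p ^ 2 / W p) p *
        (16 * N ^ 2 * (1 + 2 / N) ^ i * (W p / ℓ p / bt ℓ W V p) *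
          TS l r (i + 1) (gg l r ℓ W V) p)) := by
    intro i p c hc hT hcg
    refine hT.trans (Real.le_sqrt_of_sq_le ?_)
    have hA := le_LS (sq_div_sub hW hWa haa) i p
    have hT1 : gg l r ℓ W V p ≤ TS l r (i + 1) (gg l r ℓ W V) p :=
      le_add_of_nonneg_right (add_nonneg (TS_nonneg hg _ _) (TS_nonneg hg _ _))
    have hpow : 1 ≤ (1 + 2 / N) ^ i := one_le_pow₀ hq
    have e1 : (c * a p) ^ 2 = (a p ^ 2 / W p) * (c ^ 2 * W p) := by
      have := (hW p).ne'; field_simp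
    rw [e1]
    refine mul_le_mul hA ?_ (mul_nonneg (sq_nonneg _) (hW p).le) (LS_nonneg hA0 _ _)
    calc c ^ 2 * W p ≤ 16 * N ^ 2 * (sg l r W p ^ 2 + sg l r V p ^ 2) * W p :=
          mul_le_mul_of_nonneg_right hcg (hW p).le
      _ = 16 * N ^ 2 * 1 * (W p / ℓ p / bt ℓ W V p) * gg l r ℓ W V p := by
          have := (hℓ p).ne'; have := (hbt p).ne'
          unfold gg; field_simp
      _ ≤ _ := by
          have := (hD p).le
          have := hg p
          gcongr
  induction i generalizing p with
  | zero =>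
    refine hcase 0 p (2 * |sg l r W p|) (by positivity) ?_ ?_
    · simp only [LS]; exact (mul_comm _ _).le
    · rw [mul_pow, sq_abs]
      have : 1 ≤ N ^ 2 := one_le_pow₀ hN
      nlinarith [sq_nonneg (sg l r W p), sq_nonneg (sg l r V p),
        mul_nonneg (sub_nonneg.2 this) (sq_nonneg (sg l r W p)),
        mul_nonneg (sub_nonneg.2 this) (sq_nonneg (sg l r V p))]
  | succ i ih =>
    by_cases hs : 1 / (2 * N) ≤ |sg l r W p| ∨ 1 / (2 * N) ≤ |sg l r V p|
    · refine hcase (i + 1) p 2 (by norm_num) ?_ ?_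
      · have : ∀ q, a q * (2 * |sg l r W q|) ≤ 2 * a q := fun q => by
          have h1 : |sg l r W q| ≤ 1 := abs_le.2 (sg_bd hW hWa q)
          nlinarith [ha q]
        refine (LS_mono this _ _).trans ?_
        rw [LS_const_mul, LS_add_eq haa]
      · have hN0 : 0 < N := by linarith
        have key : (1 / (2 * N)) ^ 2 ≤ sg l r W p ^ 2 + sg l r V p ^ 2 := by
          rcases hs with h | h
          · have := pow_le_pow_left₀ (by positivity) h 2
            rw [sq_abs] at this
            linarith [sq_nonneg (sg l r V p)]
          · have := pow_le_pow_left₀ (by positivity) h 2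
            rw [sq_abs] at this
            linarith [sq_nonneg (sg l r W p)]
        have e : (2 : ℝ) ^ 2 = 16 * N ^ 2 * (1 / (2 * N)) ^ 2 := by field_simp; norm_num
        rw [e]
        exact mul_le_mul_of_nonneg_left key (by positivity)
    · push Not at hs
      have hN0 : 0 < N := by linarith
      set ρ := 1 / (2 * N) with hρ
      have hρ0 : 0 ≤ ρ := by positivity
      have hρ1 : ρ ≤ 1 / 2 := by
        rw [hρ]; exact one_div_le_one_div_of_le (by norm_num) (by linarith)
      have h4 : 1 + 2 / N = 1 + 4 * ρ := by rw [hρ]; field_simp; ring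
      obtain ⟨s1, s2⟩ := abs_lt.1 hs.1
      obtain ⟨t1, t2⟩ := abs_lt.1 hs.2
      have dl : W (l p) / ℓ (l p) / bt ℓ W V (l p) ≤ (1 + 2 / N) * (W p / ℓ p / bt ℓ W V p) := by
        rw [W_left hW hWa hℓl, bt_left hW hV hWa hVa hℓl, mul_div_mul_comm, h4]
        exact ratio_bd hρ0 hρ1 (by linarith)
          (fourth_lower hρ0 hρ1 (by linarith) (by linarith)) (hD p).le
      have dr : W (r p) / ℓ (r p) / bt ℓ W V (r p) ≤ (1 + 2 / N) * (W p / ℓ p / bt ℓ W V p) := by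
        rw [W_right hW hWa hℓr, bt_right hW hV hWa hVa hℓr, mul_div_mul_comm, h4]
        exact ratio_bd hρ0 hρ1 (by linarith)
          (fourth_lower hρ0 hρ1 (by linarith) (by linarith)) (hD p).le
      have gen : ∀ q, W q / ℓ q / bt ℓ W V q ≤ (1 + 2 / N) * (W p / ℓ p / bt ℓ W V p) →
          LS l r i (fun p => a p * (2 * |sg l r W p|)) q ≤
          √(LS l r i (fun p => a p ^ 2 / W p) q *
            (16 * N ^ 2 * (1 + 2 / N) ^ (i + 1) * (W p / ℓ p / bt ℓ W V p) *
              TS l r (i + 1) (gg l r ℓ W V) q)) := by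
        intro q hq'
        refine (ih q).trans (Real.sqrt_le_sqrt ?_)
        refine mul_le_mul_of_nonneg_left ?_ (LS_nonneg hA0 _ _)
        refine mul_le_mul_of_nonneg_right ?_ (TS_nonneg hg _ _)
        rw [pow_succ (1 + 2 / N) i, ← mul_assoc, mul_assoc _ (1 + 2 / N)]
        exact mul_le_mul_of_nonneg_left hq' (by positivity)
      have hK : 0 ≤ 16 * N ^ 2 * (1 + 2 / N) ^ (i + 1) * (W p / ℓ p / bt ℓ W V p) :=
        mul_nonneg (by positivity) (hD p).le
      have := two_cs (LS_nonneg hA0 i (l p)) (mul_nonneg hK (TS_nonneg hg (i + 1) (l p)))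
        (LS_nonneg hA0 i (r p)) (mul_nonneg hK (TS_nonneg hg (i + 1) (r p)))
        (gen _ dl) (gen _ dr)
      refine this.trans (Real.sqrt_le_sqrt ?_)
      refine mul_le_mul_of_nonneg_left ?_ (LS_nonneg hA0 (i + 1) p)
      rw [← mul_add]
      refine mul_le_mul_of_nonneg_left ?_ hK
      exact le_add_of_nonneg_left (hg p)

lemma bt_comm (ℓ W V : α → ℝ) : bt ℓ W V = bt ℓ V W := by
  funext p; simp only [bt, mul_comm]

lemma gg_comm (ℓ W V : α → ℝ) : gg l r ℓ W V = gg l r ℓ V W := by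
  funext p; simp only [gg, bt_comm ℓ W V, add_comm]

lemma bt_four {ℓ W V : α → ℝ} (hW : ∀ p, 0 < W p) (hV : ∀ p, 0 < V p) (hℓ : ∀ p, 0 < ℓ p)
    (p : α) : bt ℓ W V p ^ 4 = W p / ℓ p * (V p / ℓ p) := by
  have h : 0 ≤ W p / ℓ p * (V p / ℓ p) := by
    have := hW p; have := hV p; have := hℓ p; positivity
  unfold bt
  rw [show (4 : ℕ) = 2 * 2 from rfl, pow_mul, Real.sq_sqrt (Real.sqrt_nonneg _), Real.sq_sqrt h]

lemma pow_bd (N : ℝ) (hN : 1 ≤ N) (i : ℕ) (hi : (i : ℝ) ≤ N) : (1 + 2 / N) ^ i ≤ 8 := by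
  have hN0 : 0 < N := by linarith
  have h1 : 1 + 2 / N ≤ Real.exp (2 / N) := by linarith [Real.add_one_le_exp (2 / N)]
  have h2 := pow_le_pow_left₀ (by positivity) h1 i
  rw [← Real.exp_nat_mul] at h2
  have h3 : (i : ℝ) * (2 / N) ≤ 2 := by
    rw [← mul_div_assoc, div_le_iff₀ hN0]; linarith
  have h4 := Real.exp_le_exp.2 h3
  have h5 : Real.exp 2 ≤ 8 := by
    have e : Real.exp 2 = Real.exp 1 * Real.exp 1 := by rw [← Real.exp_add]; norm_num
    have := Real.exp_one_lt_d9
    have := Real.exp_pos 1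
    rw [e]; nlinarith
  linarith

lemma T_bound' {W V ℓ a : α → ℝ} (hW : ∀ p, 0 < W p) (hV : ∀ p, 0 < V p)
    (hWa : ∀ p, W p = W (l p) + W (r p)) (hVa : ∀ p, V p = V (l p) + V (r p))
    (hℓ : ∀ p, 0 < ℓ p) (hℓl : ∀ p, ℓ (l p) = ℓ p / 2) (hℓr : ∀ p, ℓ (r p) = ℓ p / 2)
    (haa : ∀ p, a p = a (l p) + a (r p)) (ha : ∀ p, 0 ≤ a p)
    (N : ℕ) (i : ℕ) (hi : i + 1 ≤ N) (p : α) :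
    LS l r i (fun p => a p * (2 * |sg l r W p|)) p ≤
      √(LS l r i (fun p => a p ^ 2 / W p) p *
        (128 * (N : ℝ) ^ 2 * (W p / ℓ p / bt ℓ W V p) * TS l r N (gg l r ℓ W V) p)) := by
  have hN : (1 : ℝ) ≤ N := by exact_mod_cast (by omega : 1 ≤ N)
  refine (T_bound hW hV hWa hVa hℓ hℓl hℓr haa ha N hN i p).trans (Real.sqrt_le_sqrt ?_)
  have hA0 : ∀ p, 0 ≤ a p ^ 2 / W p := fun p => div_nonneg (sq_nonneg _) (hW p).le
  have hg := gg_nonneg (l := l) (r := r) (W := W) (V := V) hℓ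
  refine mul_le_mul_of_nonneg_left ?_ (LS_nonneg hA0 _ _)
  have h1 : 0 ≤ W p / ℓ p / bt ℓ W V p := by
    have := hW p; have := hℓ p; have := bt_nonneg ℓ W V p; positivity
  have h2 := pow_bd N hN i (by exact_mod_cast (by omega : i ≤ N))
  have h3 := TS_le (l := l) (r := r) hg hi p
  have h4 := TS_nonneg (l := l) (r := r) hg (i + 1) p
  refine mul_le_mul ?_ h3 h4 (by positivity)
  refine mul_le_mul_of_nonneg_right ?_ h1
  nlinarith [sq_nonneg (N : ℝ)]

/-- The single-interval estimate. -/
lemma prod_bound {W V ℓ a b : α → ℝ} (hW : ∀ p, 0 < W p) (hV : ∀ p, 0 < V p)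
    (hWa : ∀ p, W p = W (l p) + W (r p)) (hVa : ∀ p, V p = V (l p) + V (r p))
    (hℓ : ∀ p, 0 < ℓ p) (hℓl : ∀ p, ℓ (l p) = ℓ p / 2) (hℓr : ∀ p, ℓ (r p) = ℓ p / 2)
    (haa : ∀ p, a p = a (l p) + a (r p)) (ha : ∀ p, 0 ≤ a p)
    (hbb : ∀ p, b p = b (l p) + b (r p)) (hb : ∀ p, 0 ≤ b p)
    (N m n : ℕ) (hm : m + 1 ≤ N) (hn : n + 1 ≤ N) (p : α) :
    LS l r m (fun p => a p * (2 * |sg l r W p|)) p *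
      LS l r n (fun p => b p * (2 * |sg l r V p|)) p / ℓ p ≤
      128 * (N : ℝ) ^ 2 * bt ℓ W V p ^ 3 *
      (√(LS l r m (fun p => a p ^ 2 / W p) p / W p * (LS l r n (fun p => b p ^ 2 / V p) p / V p)) *
        TS l r N (gg l r ℓ W V) p) := by
  have t1 := T_bound' hW hV hWa hVa hℓ hℓl hℓr haa ha N m hm p
  have t2 := T_bound' hV hW hVa hWa hℓ hℓl hℓr hbb hb N n hn p
  rw [bt_comm ℓ V W, gg_comm ℓ V W] at t2
  have hA0 : ∀ p, 0 ≤ a p ^ 2 / W p := fun p => div_nonneg (sq_nonneg _) (hW p).le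
  have hB0 : ∀ p, 0 ≤ b p ^ 2 / V p := fun p => div_nonneg (sq_nonneg _) (hV p).le
  have hA := LS_nonneg (l := l) (r := r) hA0 m p
  have hB := LS_nonneg (l := l) (r := r) hB0 n p
  have hg := gg_nonneg (l := l) (r := r) (W := W) (V := V) hℓ
  have hH := TS_nonneg (l := l) (r := r) hg N p
  have hT2 : 0 ≤ LS l r n (fun p => b p * (2 * |sg l r V p|)) p :=
    LS_nonneg (fun p => mul_nonneg (hb p) (by positivity)) _ _
  have hbt : 0 < bt ℓ W V p := by
    have := hW p; have := hV p; have := hℓ p; unfold bt; positivity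
  have h4 := bt_four hW hV hℓ p
  have hw := hW p
  have hv := hV p
  have hl := hℓ p
  set A := LS l r m (fun p => a p ^ 2 / W p) p
  set B := LS l r n (fun p => b p ^ 2 / V p) p
  set H := TS l r N (gg l r ℓ W V) p
  set β := bt ℓ W V p
  have t3 := mul_le_mul t1 t2 hT2 (Real.sqrt_nonneg _)
  rw [div_le_iff₀ hl]
  refine t3.trans ?_
  rw [← Real.sqrt_mul (by positivity)]
  refine (Real.sqrt_le_left (by positivity)).2 (le_of_eq ?_)
  have e : (128 * (N : ℝ) ^ 2 * β ^ 3 * (√(A / W p * (B / V p)) * H) * ℓ p) ^ 2 =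
      (128 * (N : ℝ) ^ 2 * β ^ 3 * H * ℓ p) ^ 2 * (A / W p * (B / V p)) := by
    have := Real.sq_sqrt (show 0 ≤ A / W p * (B / V p) by positivity)
    rw [← this]; simp only [Real.sqrt_sq (Real.sqrt_nonneg _)]; ring
  rw [e]
  have e2 : W p * V p = β ^ 4 * ℓ p ^ 2 := by rw [h4]; field_simp
  have e3 : A * (128 * (N : ℝ) ^ 2 * (W p / ℓ p / β) * H) *
      (B * (128 * (N : ℝ) ^ 2 * (V p / ℓ p / β) * H)) =
      (128 * (N : ℝ) ^ 2 * H) ^ 2 * (A * B) * (W p * V p) / (ℓ p * β) ^ 2 := by field_simp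
  have e4 : (128 * (N : ℝ) ^ 2 * β ^ 3 * H * ℓ p) ^ 2 * (A / W p * (B / V p)) =
      (128 * (N : ℝ) ^ 2 * β ^ 3 * H * ℓ p) ^ 2 * (A * B) / (W p * V p) := by field_simp
  rw [e3, e4, e2]
  field_simp

/-- The abstract theorem on a finite tree. -/
lemma tree_bound {W V ℓ a b X Y : α → ℝ} (hW : ∀ p, 0 < W p) (hV : ∀ p, 0 < V p)
    (hWa : ∀ p, W p = W (l p) + W (r p)) (hVa : ∀ p, V p = V (l p) + V (r p))
    (hℓ : ∀ p, 0 < ℓ p) (hℓl : ∀ p, ℓ (l p) = ℓ p / 2) (hℓr : ∀ p, ℓ (r p) = ℓ p / 2)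
    (haa : ∀ p, a p = a (l p) + a (r p)) (ha : ∀ p, 0 ≤ a p)
    (hbb : ∀ p, b p = b (l p) + b (r p)) (hb : ∀ p, 0 ≤ b p)
    (hXa : ∀ p, X p = X (l p) + X (r p)) (hYa : ∀ p, Y p = Y (l p) + Y (r p))
    (hX : ∀ p, a p ^ 2 ≤ X p * W p) (hY : ∀ p, b p ^ 2 ≤ Y p * V p)
    (hWV : ∀ p, ℓ p ^ 2 ≤ W p * V p)
    (Q : ℝ) (hQ1 : 1 ≤ Q) (hQ : ∀ p, W p / ℓ p * (V p / ℓ p) ≤ Q)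
    (m n d : ℕ) (p : α) :
    TS l r d (fun p => LS l r m (fun p => a p * (2 * |sg l r W p|)) p *
      LS l r n (fun p => b p * (2 * |sg l r V p|)) p / ℓ p) p ≤
      8192 * ((m : ℝ) + n + 1) ^ 4 * Q * √(X p * Y p) := by
  set N : ℕ := m + n + 1 with hN
  have hNR : ((m : ℝ) + n + 1) = (N : ℝ) := by rw [hN]; push_cast; ring
  rw [hNR]
  set q := √√Q with hq
  have hq0 : 0 ≤ q := Real.sqrt_nonneg _
  have hq4 : q ^ 4 = Q := by
    rw [hq, show (4 : ℕ) = 2 * 2 from rfl, pow_mul, Real.sq_sqrt (Real.sqrt_nonneg _),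
      Real.sq_sqrt (by linarith)]
  have hbq : ∀ p, bt ℓ W V p ≤ q := fun p => Real.sqrt_le_sqrt (Real.sqrt_le_sqrt (hQ p))
  have hℓa : ∀ p, ℓ p = ℓ (l p) + ℓ (r p) := fun p => by rw [hℓl, hℓr]; ring
  set bl : α → ℝ := fun p => bt ℓ W V p * ℓ p with hbl
  have hbl0 : ∀ p, 0 ≤ bl p := fun p => mul_nonneg (bt_nonneg _ _ _ _) (hℓ p).le
  set Θ : α → ℝ := fun p => TS l r N bl p with hΘ
  have hg := gg_nonneg (l := l) (r := r) (W := W) (V := V) hℓ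
  have hTΘ : ∀ p, Θ p - (Θ (l p) + Θ (r p)) = bl p - LS l r N bl p := by
    intro p
    simp only [hΘ, TS_eq_sum]
    rw [← Finset.sum_add_distrib, ← Finset.sum_sub_distrib]
    have := Finset.sum_range_sub' (fun i => LS l r i bl p) N
    exact this
  have hgΘ : ∀ p, TS l r N (gg l r ℓ W V) p ≤ 16 * (Θ p - (Θ (l p) + Θ (r p))) := fun p => by
    rw [hTΘ]; exact TS_gg hW hV hWa hVa hℓ hℓl hℓr N p
  have hΘB : ∀ p, Θ p ≤ (N * q) * ℓ p := by
    intro p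
    simp only [hΘ, TS_eq_sum]
    have : ∀ i ∈ Finset.range N, LS l r i bl p ≤ q * ℓ p := by
      intro i _
      refine (LS_mono (g := fun p => q * ℓ p)
        (fun p => mul_le_mul_of_nonneg_right (hbq p) (hℓ p).le) i p).trans ?_
      rw [LS_const_mul, LS_add_eq hℓa]
    refine (Finset.sum_le_sum this).trans ?_
    rw [Finset.sum_const, Finset.card_range, nsmul_eq_mul, mul_assoc]
  set F₁ : α → ℝ := fun p => LS l r m (fun p => a p ^ 2 / W p) p / W p with hF₁
  set F₂ : α → ℝ := fun p => LS l r n (fun p => b p ^ 2 / V p) p / V p with hF₂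
  have hF20 : ∀ p, 0 ≤ F₂ p := fun p =>
    div_nonneg (LS_nonneg (fun p => div_nonneg (sq_nonneg _) (hV p).le) _ _) (hV p).le
  have step1 : ∀ p, LS l r m (fun p => a p * (2 * |sg l r W p|)) p *
      LS l r n (fun p => b p * (2 * |sg l r V p|)) p / ℓ p ≤
      (2048 * (N : ℝ) ^ 2 * q ^ 3) * (√(F₁ p * F₂ p) * (Θ p - (Θ (l p) + Θ (r p)))) := by
    intro p
    refine (prod_bound hW hV hWa hVa hℓ hℓl hℓr haa ha hbb hb N m n (by omega) (by omega) p).trans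
      ?_
    have h1 : bt ℓ W V p ^ 3 ≤ q ^ 3 := pow_le_pow_left₀ (bt_nonneg _ _ _ _) (hbq p) 3
    have h2 := TS_nonneg (l := l) (r := r) hg N p
    calc _ ≤ 128 * (N : ℝ) ^ 2 * q ^ 3 * (√(F₁ p * F₂ p) *
          (16 * (Θ p - (Θ (l p) + Θ (r p))))) := by
          refine mul_le_mul ?_ ?_ (by positivity) (by positivity)
          · exact mul_le_mul_of_nonneg_left h1 (by positivity)
          · exact mul_le_mul_of_nonneg_left (hgΘ p) (Real.sqrt_nonneg _)
      _ = _ := by ring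
  refine (TS_mono step1 d p).trans ?_
  rw [TS_const_mul]
  have hsup : ∀ p, Θ (l p) + Θ (r p) ≤ Θ p := fun p => by
    linarith [hgΘ p, TS_nonneg (l := l) (r := r) hg N p]
  have step2 := carleson (F := fun p => √(F₁ p * F₂ p)) hℓa (fun p => TS_nonneg hbl0 N p) hΘB
    hsup d 0 le_rfl p
  have step3 := GM_cs (l := l) (r := r) (F₁ := F₁) (F₂ := F₂) (fun p => (hℓ p).le)
    (fun p => (hW p).le) (fun p => (hV p).le) hF20 hWV d 0 0 0 le_rfl le_rfl (by simp) p
  have m1 := GM_max hW hWa haa hXa ha hX m d p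
  have m2 := GM_max hV hVa hbb hYa hb hY n d p
  have hG1 := GM_nonneg (l := l) (r := r) (F := F₁) (fun p => (hW p).le) d 0 le_rfl p
  have hG2 := GM_nonneg (l := l) (r := r) (F := F₂) (fun p => (hV p).le) d 0 le_rfl p
  have hX0 : 0 ≤ X p := by
    by_contra h; push Not at h; nlinarith [hX p, sq_nonneg (a p), hW p]
  have hY0 : 0 ≤ Y p := by
    by_contra h; push Not at h; nlinarith [hY p, sq_nonneg (b p), hV p]
  have n1 : (4 + m : ℝ) ≤ 4 * N := by rw [← hNR]; have : (0:ℝ) ≤ m := by positivity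
                                      have : (0:ℝ) ≤ n := by positivity
                                      linarith
  have n2 : (4 + n : ℝ) ≤ 4 * N := by rw [← hNR]; have : (0:ℝ) ≤ m := by positivity
                                      have : (0:ℝ) ≤ n := by positivity
                                      linarith
  have step4 : √(GM l r F₁ W d 0 p * GM l r F₂ V d 0 p) ≤ 4 * N * √(X p * Y p) := by
    have : √((4 * N : ℝ) ^ 2 * (X p * Y p)) = 4 * N * √(X p * Y p) := by
      rw [Real.sqrt_mul (by positivity), Real.sqrt_sq (by positivity)]
    rw [← this]
    refine Real.sqrt_le_sqrt ?_
    have k1 : GM l r F₁ W d 0 p ≤ 4 * N * X p := m1.trans (mul_le_mul_of_nonneg_right n1 hX0)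
    have k2 : GM l r F₂ V d 0 p ≤ 4 * N * Y p := m2.trans (mul_le_mul_of_nonneg_right n2 hY0)
    calc _ ≤ (4 * N * X p) * (4 * N * Y p) := mul_le_mul k1 k2 hG2 (by positivity)
      _ = _ := by ring
  simp only [zero_mul, sub_zero, add_zero] at step2
  calc _ ≤ 2048 * (N : ℝ) ^ 2 * q ^ 3 * (N * q * (4 * N * √(X p * Y p))) := by
        refine mul_le_mul_of_nonneg_left (step2.trans ?_) (by positivity)
        exact mul_le_mul_of_nonneg_left (step3.trans step4) (by positivity)
    _ = 8192 * (N : ℝ) ^ 4 * q ^ 4 * √(X p * Y p) := by ring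
    _ = _ := by rw [hq4]

end Tree

section Concrete

/-- left child -/
def lc (p : ℤ × ℤ) : ℤ × ℤ := (p.1 + 1, 2 * p.2)
/-- right child -/
def rc (p : ℤ × ℤ) : ℤ × ℤ := (p.1 + 1, 2 * p.2 + 1)

lemma sum_Ico_split (f : ℤ → ℝ) {a b c : ℤ} (h1 : a ≤ b) (h2 : b ≤ c) :
    ∑ k ∈ Finset.Ico a b, f k + ∑ k ∈ Finset.Ico b c, f k = ∑ k ∈ Finset.Ico a c, f k := by
  rw [← Finset.sum_union (Finset.Ico_disjoint_Ico_consecutive a b c),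
    Finset.Ico_union_Ico_eq_Ico h1 h2]

lemma LS_eq (f : ℤ × ℤ → ℝ) (i : ℕ) (j k : ℤ) :
    LS lc rc i f (j, k) =
      ∑ q ∈ Finset.Ico ((2 : ℤ) ^ i * k) ((2 : ℤ) ^ i * (k + 1)), f (j + i, q) := by
  induction i generalizing j k with
  | zero =>
    have : Finset.Ico k (k + 1) = {k} := by ext x; simp; omega
    simp [LS, this]
  | succ i ih =>
    have hp : (0 : ℤ) < 2 ^ i := by positivity
    simp only [LS, lc, rc, ih]
    have e : j + 1 + (i : ℤ) = j + ((i + 1 : ℕ) : ℤ) := by push_cast; ring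
    rw [e, sum_Ico_split (fun q => f (j + ((i + 1 : ℕ) : ℤ), q)) (by nlinarith) (by nlinarith)]
    congr 2 <;> ring

lemma LS_sum (f : ℤ × ℤ → ℝ) (i : ℕ) (j A B : ℤ) (hAB : A ≤ B) :
    ∑ k ∈ Finset.Ico A B, LS lc rc i f (j, k) =
      ∑ q ∈ Finset.Ico ((2 : ℤ) ^ i * A) ((2 : ℤ) ^ i * B), f (j + i, q) := by
  have hp : (0 : ℤ) < 2 ^ i := by positivity
  induction B, hAB using Int.leInduction with
  | base => simp
  | succ B hB ih =>
    rw [← sum_Ico_split _ hB (by linarith : B ≤ B + 1), ih,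
      ← sum_Ico_split (fun q => f (j + i, q)) (show (2 : ℤ) ^ i * A ≤ 2 ^ i * B by nlinarith)
        (show (2 : ℤ) ^ i * B ≤ 2 ^ i * (B + 1) by nlinarith)]
    congr 1
    have : Finset.Ico B (B + 1) = {B} := by ext x; simp; omega
    rw [this, Finset.sum_singleton, LS_eq]

lemma dlen_pos (j : ℤ) : 0 < dlen j := by unfold dlen; positivity

lemma dlen_succ (j : ℤ) : dlen (j + 1) = dlen j / 2 := by
  unfold dlen
  rw [neg_add, zpow_add₀ (by norm_num)]
  norm_num
  ring

lemma dyad_union (j k : ℤ) : dyad j k = dyad (j + 1) (2 * k) ∪ dyad (j + 1) (2 * k + 1) := by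
  have h := dlen_pos j
  unfold dyad
  rw [dlen_succ]
  push_cast
  rw [Set.Ico_union_Ico_eq_Ico (by nlinarith) (by nlinarith)]
  congr 1 <;> ring

lemma dyad_disj (j k : ℤ) : Disjoint (dyad (j + 1) (2 * k)) (dyad (j + 1) (2 * k + 1)) := by
  unfold dyad
  push_cast
  exact Set.Ico_disjoint_Ico.2 (by simp)

lemma dyad_meas (j k : ℤ) : MeasurableSet (dyad j k) := measurableSet_Ico

lemma dyad_vol (j k : ℤ) : volume (dyad j k) = ENNReal.ofReal (dlen j) := by
  unfold dyad; rw [Real.volume_Ico]; congr 1; ring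

lemma dyad_int {f : ℝ → ℝ} (hf : LocallyIntegrable f) (j k : ℤ) : IntegrableOn f (dyad j k) :=
  (hf.integrableOn_isCompact (isCompact_Icc (a := (k : ℝ) * dlen j)
    (b := ((k : ℝ) + 1) * dlen j))).mono_set Set.Ico_subset_Icc_self

/-- integral over the dyadic interval -/
def DI (f : ℝ → ℝ) (p : ℤ × ℤ) : ℝ := ∫ x in dyad p.1 p.2, f x

lemma DI_add {f : ℝ → ℝ} (hf : ∀ j k, IntegrableOn f (dyad j k)) (p : ℤ × ℤ) :
    DI f p = DI f (lc p) + DI f (rc p) := by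
  unfold DI lc rc
  rw [dyad_union p.1 p.2, setIntegral_union (dyad_disj _ _) (dyad_meas _ _) (hf _ _) (hf _ _)]

lemma DI_pos {f : ℝ → ℝ} (hf : ∀ j k, IntegrableOn f (dyad j k)) (h : ∀ x, 0 < f x)
    (p : ℤ × ℤ) : 0 < DI f p := by
  unfold DI
  rw [setIntegral_pos_iff_support_of_nonneg_ae (Filter.Eventually.of_forall fun x => (h x).le)
    (hf _ _)]
  have : Function.support f = Set.univ := by ext x; simp [(h x).ne']
  rw [this, Set.univ_inter, dyad_vol]
  simpa using dlen_pos _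

lemma DI_nonneg {f : ℝ → ℝ} (h : ∀ x, 0 ≤ f x) (p : ℤ × ℤ) : 0 ≤ DI f p :=
  integral_nonneg h

lemma DI_cs {f g h : ℝ → ℝ} (hf : ∀ j k, IntegrableOn f (dyad j k))
    (hg : ∀ j k, IntegrableOn g (dyad j k)) (hh : ∀ j k, IntegrableOn h (dyad j k))
    (hpos : ∀ p, 0 < DI g p) (hq : ∀ t x, 0 ≤ f x - 2 * t * h x + t ^ 2 * g x) (p : ℤ × ℤ) :
    DI h p ^ 2 ≤ DI f p * DI g p := by
  have key : ∀ t, 0 ≤ DI f p - 2 * t * DI h p + t ^ 2 * DI g p := by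
    intro t
    have h0 : 0 ≤ DI (fun x => f x - 2 * t * h x + t ^ 2 * g x) p := DI_nonneg (hq t) p
    have e : DI (fun x => f x - 2 * t * h x + t ^ 2 * g x) p =
        DI f p - 2 * t * DI h p + t ^ 2 * DI g p := by
      unfold DI
      rw [integral_add, integral_sub, integral_const_mul, integral_const_mul]
      · exact hf _ _
      · exact (hh _ _).const_mul _
      · exact (hf _ _).sub ((hh _ _).const_mul _)
      · exact (hg _ _).const_mul _
    linarith
  have hg0 := hpos p
  have h1 := key (DI h p / DI g p)
  have e : DI f p - 2 * (DI h p / DI g p) * DI h p + (DI h p / DI g p) ^ 2 * DI g p =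
      DI f p - DI h p ^ 2 / DI g p := by field_simp; ring
  rw [e, sub_nonneg, div_le_iff₀ hg0] at h1
  exact h1

lemma avg_eq (f : ℝ → ℝ) (j k : ℤ) : avg f j k = DI f (j, k) / dlen j := by
  unfold avg DI; rw [inv_mul_eq_div]

lemma dOsc_ratio {v : ℝ → ℝ} (hv : ∀ j k, IntegrableOn v (dyad j k)) (h : ∀ x, 0 < v x)
    (j k : ℤ) : dOsc v j k / avg v j k = 2 * |sg lc rc (DI v) (j, k)| := by
  have hp := DI_pos hv h (j, k)
  have hl := dlen_pos j
  have ha := DI_add hv (j, k)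
  have h1 : avg v (j + 1) (2 * k) - avg v j k =
      -(sg lc rc (DI v) (j, k) * avg v j k) := by
    rw [avg_eq, avg_eq, dlen_succ, sg]
    change DI v (lc (j, k)) / _ - _ = _
    field_simp; linarith
  have h2 : avg v (j + 1) (2 * k + 1) - avg v j k = sg lc rc (DI v) (j, k) * avg v j k := by
    rw [avg_eq, avg_eq, dlen_succ, sg]
    change DI v (rc (j, k)) / _ - _ = _
    field_simp; linarith
  have h3 : 0 < avg v j k := by rw [avg_eq]; positivity
  rw [dOsc, h1, h2, abs_neg, abs_mul, abs_of_pos h3]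
  field_simp; ring

lemma RL_eq {v : ℝ → ℝ} (hv : ∀ j k, IntegrableOn v (dyad j k)) (h : ∀ x, 0 < v x)
    (m : ℕ) (φ : ℝ → ℝ) (p : ℤ × ℤ) :
    RL v m φ p.1 p.2 = LS lc rc m
      (fun q => DI (fun x => |φ x| * v x) q * (2 * |sg lc rc (DI v) q|)) p / √(dlen p.1) := by
  obtain ⟨j, k⟩ := p
  rw [LS_eq, Finset.sum_div, RL]
  refine Finset.sum_congr rfl fun q _ => ?_
  rw [dOsc_ratio hv h, avg_eq]
  have := dlen_pos (j + m)
  field_simp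

lemma phi_int {v φ : ℝ → ℝ} (hv : LocallyIntegrable v) (h : ∀ x, 0 < v x) (hvm : Measurable v)
    (hφ : Measurable φ) (hI : Integrable (fun x => (φ x) ^ 2 * v x)) (j k : ℤ) :
    IntegrableOn (fun x => |φ x| * v x) (dyad j k) := by
  refine Integrable.mono' (hI.integrableOn.add (dyad_int hv j k))
    (hφ.abs.mul hvm).aestronglyMeasurable (Filter.Eventually.of_forall fun x => ?_)
  have := h x
  rw [Real.norm_of_nonneg (by positivity)]
  simp only [Pi.add_apply]
  have h2 : |φ x| ≤ φ x ^ 2 + 1 := by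
    rw [← sq_abs]; nlinarith [sq_nonneg (|φ x| - 1), abs_nonneg (φ x)]
  nlinarith

lemma dyad_pairwise (j : ℤ) : Pairwise (Function.onFun Disjoint (fun k => dyad j k)) := by
  intro a b hab
  have hl := dlen_pos j
  refine Set.disjoint_left.2 fun x hx hy => hab ?_
  have h1 : (a : ℝ) < b + 1 := lt_of_mul_lt_mul_right (hx.1.trans_lt hy.2) hl.le
  have h2 : (b : ℝ) < a + 1 := lt_of_mul_lt_mul_right (hy.1.trans_lt hx.2) hl.le
  have h1' : a < b + 1 := by exact_mod_cast h1
  have h2' : b < a + 1 := by exact_mod_cast h2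
  omega

lemma DI_sum_le {f : ℝ → ℝ} (hf : Integrable f) (h : ∀ x, 0 ≤ f x) (j : ℤ) (s : Finset ℤ) :
    ∑ k ∈ s, DI f (j, k) ≤ ∫ x, f x := by
  unfold DI
  rw [← integral_biUnion_finset s (fun k _ => dyad_meas j k)
    (fun a _ b _ hab => dyad_pairwise j hab) (fun _ _ => hf.integrableOn)]
  exact setIntegral_le_integral hf (Filter.Eventually.of_forall h)

lemma finset_bound (t : ℤ × ℤ → ℝ) (ht : ∀ p, 0 ≤ t p) (F : Finset (ℤ × ℤ)) :
    ∃ (j : ℤ) (d : ℕ) (s : Finset ℤ), ∑ p ∈ F, t p ≤ ∑ k ∈ s, TS lc rc d t (j, k) := by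
  obtain ⟨R, hR⟩ : ∃ R : ℕ, ∀ p ∈ F, p.1.natAbs ≤ R ∧ p.2.natAbs ≤ R := by
    refine ⟨∑ p ∈ F, (p.1.natAbs + p.2.natAbs), fun p hp => ?_⟩
    have := Finset.single_le_sum (f := fun p : ℤ × ℤ => p.1.natAbs + p.2.natAbs)
      (fun _ _ => Nat.zero_le _) hp
    omega
  refine ⟨-R, 2 * R + 1, Finset.Ico (-((R : ℤ) + 1)) ((R : ℤ) + 1), ?_⟩
  simp only [TS_eq_sum]
  rw [Finset.sum_comm]
  have e : ∀ i ∈ Finset.range (2 * R + 1),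
      ∑ k ∈ Finset.Ico (-((R : ℤ) + 1)) ((R : ℤ) + 1), LS lc rc i t (-(R : ℤ), k) =
      ∑ q ∈ Finset.Ico ((2 : ℤ) ^ i * (-((R : ℤ) + 1))) ((2 : ℤ) ^ i * ((R : ℤ) + 1)),
        t (-(R : ℤ) + i, q) := fun i _ => LS_sum t i _ _ _ (by omega)
  rw [Finset.sum_congr rfl e, Finset.sum_sigma']
  have hinj : Set.InjOn (fun p : ℤ × ℤ => (⟨(p.1 + R).toNat, p.2⟩ : Σ _ : ℕ, ℤ)) F := by
    intro a ha b hb hab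
    have h1 := hR a ha
    have h2 := hR b hb
    simp only [Sigma.mk.injEq, heq_eq_eq] at hab
    refine Prod.ext ?_ hab.2
    have := hab.1
    omega
  have hE : ∑ p ∈ F, t p = ∑ y ∈ F.image
      (fun p : ℤ × ℤ => (⟨(p.1 + R).toNat, p.2⟩ : Σ _ : ℕ, ℤ)), t (-(R : ℤ) + y.1, y.2) := by
    rw [Finset.sum_image hinj]
    refine Finset.sum_congr rfl fun p hp => ?_
    have h1 := hR p hp
    congr 1
    refine Prod.ext ?_ rfl
    simp only
    omega
  rw [hE]
  refine Finset.sum_le_sum_of_subset_of_nonneg ?_ (fun _ _ _ => ht _)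
  intro y hy
  obtain ⟨p, hp, rfl⟩ := Finset.mem_image.1 hy
  have h1 := hR p hp
  have h2 : (1 : ℤ) ≤ 2 ^ ((p.1 + R).toNat) := one_le_pow₀ (by norm_num)
  simp only [Finset.mem_sigma, Finset.mem_range, Finset.mem_Ico]
  refine ⟨by omega, ?_, ?_⟩
  · have : -((R : ℤ) + 1) ≤ p.2 := by omega
    nlinarith
  · have : p.2 < (R : ℤ) + 1 := by omega
    nlinarith

end Concrete

/-- `∑_L R_L(φw) R_L(ψσ) ≤ C (m+n+1)⁴ [w]_{A₂} ‖φ‖_{L²(w)} ‖ψ‖_{L²(σ)}`. -/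
theorem sum_RL_RL_bound :
    ∃ C : ℝ, 0 < C ∧
      ∀ (m n : ℕ) (w : ℝ → ℝ), (∀ x, 0 < w x) → Measurable w →
        LocallyIntegrable w → LocallyIntegrable (fun x => (w x)⁻¹) →
      ∀ Q : ℝ, 1 ≤ Q →
        (∀ j k : ℤ, avg w j k * avg (fun x => (w x)⁻¹) j k ≤ Q) →
      ∀ φ ψ : ℝ → ℝ, Measurable φ → Measurable ψ →
        Integrable (fun x => (φ x) ^ 2 * w x) →
        Integrable (fun x => (ψ x) ^ 2 * (w x)⁻¹) →
        (∑' L : ℤ × ℤ,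
            ENNReal.ofReal (RL w m φ L.1 L.2 *
              RL (fun x => (w x)⁻¹) n ψ L.1 L.2))
          ≤ ENNReal.ofReal (C * ((m : ℝ) + n + 1) ^ 4 * Q *
              Real.sqrt (∫ x, (φ x) ^ 2 * w x) *
              Real.sqrt (∫ x, (ψ x) ^ 2 * (w x)⁻¹)) := by
  refine ⟨8192, by norm_num, ?_⟩
  intro m n w hw hwm hwi hσi Q hQ1 hQ φ ψ hφ hψ hφI hψI
  set σ : ℝ → ℝ := fun x => (w x)⁻¹ with hσ
  have hσ0 : ∀ x, 0 < σ x := fun x => inv_pos.2 (hw x)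
  have hσm : Measurable σ := hwm.inv
  have iw := dyad_int hwi
  have iσ := dyad_int hσi
  have ia := phi_int hwi hw hwm hφ hφI
  have ib := phi_int hσi hσ0 hσm hψ hψI
  have iX : ∀ j k, IntegrableOn (fun x => φ x ^ 2 * w x) (dyad j k) := fun _ _ => hφI.integrableOn
  have iY : ∀ j k, IntegrableOn (fun x => ψ x ^ 2 * σ x) (dyad j k) := fun _ _ => hψI.integrableOn
  have hX0 : ∀ x, 0 ≤ φ x ^ 2 * w x := fun x => mul_nonneg (sq_nonneg _) (hw x).le
  have hY0 : ∀ x, 0 ≤ ψ x ^ 2 * σ x := fun x => mul_nonneg (sq_nonneg _) (hσ0 x).le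
  have pW := DI_pos iw hw
  have pV := DI_pos iσ hσ0
  have ha0 : ∀ p, 0 ≤ DI (fun x => |φ x| * w x) p :=
    DI_nonneg fun x => mul_nonneg (abs_nonneg _) (hw x).le
  have hb0 : ∀ p, 0 ≤ DI (fun x => |ψ x| * σ x) p :=
    DI_nonneg fun x => mul_nonneg (abs_nonneg _) (hσ0 x).le
  have cX : ∀ p, DI (fun x => |φ x| * w x) p ^ 2 ≤ DI (fun x => φ x ^ 2 * w x) p * DI w p := by
    refine DI_cs iX iw ia pW fun t x => ?_
    have := mul_nonneg (sq_nonneg (|φ x| - t)) (hw x).le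
    rw [← sq_abs (φ x)]; nlinarith
  have cY : ∀ p, DI (fun x => |ψ x| * σ x) p ^ 2 ≤ DI (fun x => ψ x ^ 2 * σ x) p * DI σ p := by
    refine DI_cs iY iσ ib pV fun t x => ?_
    have := mul_nonneg (sq_nonneg (|ψ x| - t)) (hσ0 x).le
    rw [← sq_abs (ψ x)]; nlinarith
  have hone : ∀ p : ℤ × ℤ, DI (fun _ => (1 : ℝ)) p = dlen p.1 := fun p => by
    unfold DI
    rw [setIntegral_const, Measure.real, dyad_vol, ENNReal.toReal_ofReal (dlen_pos _).le]
    simp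
  have cWV : ∀ p : ℤ × ℤ, dlen p.1 ^ 2 ≤ DI w p * DI σ p := by
    intro p
    rw [← hone p]
    refine DI_cs iw iσ (fun j k => ?_) pV (fun t x => ?_) p
    · exact integrableOn_const (by rw [dyad_vol]; exact ENNReal.ofReal_ne_top)
    · have h1 : w x * σ x = 1 := mul_inv_cancel₀ (hw x).ne'
      have h2 := mul_nonneg (sq_nonneg (w x - t)) (hσ0 x).le
      have e : (w x - t) ^ 2 * σ x = w x * (w x * σ x) - 2 * t * (w x * σ x) + t ^ 2 * σ x := by
        ring
      rw [e, h1] at h2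
      linarith
  have hQ' : ∀ p : ℤ × ℤ, DI w p / dlen p.1 * (DI σ p / dlen p.1) ≤ Q := by
    intro p
    have := hQ p.1 p.2
    rwa [avg_eq, avg_eq] at this
  have hT := fun d p => tree_bound (l := lc) (r := rc) (ℓ := fun p => dlen p.1) pW pV (DI_add iw)
    (DI_add iσ) (fun p => dlen_pos _) (fun p => dlen_succ _) (fun p => dlen_succ _)
    (DI_add ia) ha0 (DI_add ib) hb0 (DI_add iX) (DI_add iY) cX cY cWV Q hQ1 hQ' m n d p
  set T : ℤ × ℤ → ℝ := fun p => LS lc rc m (fun p => DI (fun x => |φ x| * w x) p *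
      (2 * |sg lc rc (DI w) p|)) p * LS lc rc n (fun p => DI (fun x => |ψ x| * σ x) p *
      (2 * |sg lc rc (DI σ) p|)) p / dlen p.1 with hTdef
  have hRL : ∀ p : ℤ × ℤ, RL w m φ p.1 p.2 * RL σ n ψ p.1 p.2 = T p := by
    intro p
    rw [RL_eq iw hw, RL_eq iσ hσ0, div_mul_div_comm, Real.mul_self_sqrt (dlen_pos _).le]
  have hT0 : ∀ p, 0 ≤ T p := fun p => div_nonneg (mul_nonneg
    (LS_nonneg (fun q => mul_nonneg (ha0 q) (by positivity)) _ _)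
    (LS_nonneg (fun q => mul_nonneg (hb0 q) (by positivity)) _ _)) (dlen_pos _).le
  simp only [hRL]
  rw [ENNReal.tsum_eq_iSup_sum]
  refine iSup_le fun F => ?_
  rw [← ENNReal.ofReal_sum_of_nonneg fun p _ => hT0 p]
  refine ENNReal.ofReal_le_ofReal ?_
  obtain ⟨j, d, s, hF⟩ := finset_bound T hT0 F
  refine hF.trans ((Finset.sum_le_sum fun k _ => hT d (j, k)).trans ?_)
  rw [← Finset.mul_sum, mul_assoc _ (√_) (√_)]
  refine mul_le_mul_of_nonneg_left ?_ (by positivity)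
  have hxn := DI_nonneg hX0
  have hyn := DI_nonneg hY0
  calc _ = ∑ k ∈ s, √(DI (fun x => φ x ^ 2 * w x) (j, k)) * √(DI (fun x => ψ x ^ 2 * σ x) (j, k)) :=
        Finset.sum_congr rfl fun k _ => Real.sqrt_mul (hxn _) _
    _ ≤ √(∑ k ∈ s, DI (fun x => φ x ^ 2 * w x) (j, k)) *
        √(∑ k ∈ s, DI (fun x => ψ x ^ 2 * σ x) (j, k)) :=
        Real.sum_sqrt_mul_sqrt_le s (fun k => hxn _) (fun k => hyn _)
    _ ≤ _ := mul_le_mul (Real.sqrt_le_sqrt (DI_sum_le hφI hX0 j s))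
        (Real.sqrt_le_sqrt (DI_sum_le hψI hY0 j s)) (Real.sqrt_nonneg _) (Real.sqrt_nonneg _)
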